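/- Let α : ℝ → ℝ be locally Lipschitz, strictly increasing, and satisfy α(0) = 0 (a locally Lipschitz class K∞ function). Let y : ℝ → ℝ be differentiable on [0, ∞) with y(0) ≥ 0 and deriv y t ≥ −α(y t) for all t ≥ 0. Then y t ≥ 0 for all t ≥ 0. -/

import Mathlib

/-- Forward invariance under a locally Lipschitz class-K∞
comparison function: if `α` is locally Lipschitz, strictly increasing with
`α 0 = 0`, `y` is differentiable on `[0, ∞)`, `y 0 ≥ 0`, and
`y′(t) ≥ −α(y t)` for all `t ≥ 0`, then `y t ≥ 0` for all `t ≥ 0`. -/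
theorem stmt_11 (α : ℝ → ℝ) (hα_lip : LocallyLipschitz α) (hα_mono : StrictMono α)
    (hα_zero : α 0 = 0)
    (y : ℝ → ℝ) (hy : DifferentiableOn ℝ y (Set.Ici 0)) (hy0 : 0 ≤ y 0)
    (hineq : ∀ t ≥ (0 : ℝ), deriv y t ≥ -α (y t)) :
    ∀ t ≥ (0 : ℝ), 0 ≤ y t := by
  intro t ht
  refine le_of_forall_pos_le_add fun r hr => ?_
  -- Fence `-y` by the constant `r`; the value `r` cannot be attained at time `0`.
  have fence : -y t ≤ r := by
    refine image_le_of_deriv_right_lt_deriv_boundary (f := fun x => -y x)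
      (f' := fun x => -derivWithin y (Set.Ici 0) x) (B := fun _ => r) (B' := fun _ => 0)
      (hy.continuousOn.mono Set.Icc_subset_Ici_self).neg
      (fun x hx => ((hy x hx.1).hasDerivWithinAt.mono (Set.Ici_subset_Ici.2 hx.1)).neg)
      (by linarith) (fun x => hasDerivAt_const x r) (fun x hx hxr => ?_) ⟨ht, le_refl t⟩
    have hyx : y x < 0 := by linarith
    have hx0 : 0 < x := hx.1.lt_of_ne (by rintro rfl; linarith)
    have hα : α (y x) < 0 := hα_zero ▸ hα_mono hyx
    have hderiv := hineq x hx.1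
    rw [derivWithin_of_mem_nhds (Ici_mem_nhds hx0)]
    linarith
  linarith
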